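/- Assume each feature satisfies E[xᵢ|y] = y·μᵢ and Var(xᵢ|y) = σᵢ², with features conditionally independent given y. Then any minimizer w* of the regularized soft-SVM objective satisfies ‖w*‖₂ ≥ (1/‖μ‖₂)·(1 - (1/2)(σ̄_μ/‖μ‖₂ + λ/(2‖μ‖₂²))), where μ = (μ₁,…,μ_d) and σ̄_μ² = (Σᵢ μᵢ²σᵢ²)/(Σᵢ μᵢ²). -/

import Mathlib

open MeasureTheory Finset
open scoped ENNReal

/-- The joint distribution of `(x,y)` on `ℝ^d × {-1,1}`: with probability `q` the label is `1`
and the features are drawn from the product measure `Measure.pi ηp` (features conditionally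
independent given the label), with probability `1-q` the label is `-1` and the features are
drawn from `Measure.pi ηn`. -/
noncomputable def jointMeasure {d : ℕ} (ηp ηn : Fin d → Measure ℝ) (q : ℝ≥0∞) :
    Measure ((Fin d → ℝ) × ℝ) :=
  q • (Measure.pi ηp).map (fun x => (x, (1 : ℝ))) +
    (1 - q) • (Measure.pi ηn).map (fun x => (x, (-1 : ℝ)))

/-- The regularized soft-SVM objective. -/
noncomputable def svmLoss {d : ℕ} (μ : Measure ((Fin d → ℝ) × ℝ)) (lam : ℝ)
    (w : Fin d → ℝ) : ℝ :=
  (∫ p, max 0 (1 - p.2 * ∑ i, w i * p.1 i) ∂μ) + lam / 2 * ∑ i, (w i) ^ 2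

noncomputable def hingeAux {d : ℕ} (η : Fin d → Measure ℝ) (w : Fin d → ℝ) : ℝ :=
  ∫ x, max 0 (1 - ∑ i, w i * x i) ∂(Measure.pi η)

section aux
variable {d : ℕ} (η : Fin d → Measure ℝ) [∀ i, IsProbabilityMeasure (η i)]

lemma aux_memLp_id (hi : ∀ j, Integrable (fun t : ℝ => t ^ 2) (η j)) (i : Fin d) :
    MemLp (fun t : ℝ => t) 2 (η i) :=
  (memLp_two_iff_integrable_sq (by fun_prop)).2 (hi i)

lemma aux_memLp (hi : ∀ j, Integrable (fun t : ℝ => t ^ 2) (η j)) (w : Fin d → ℝ) :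
    MemLp (fun x : Fin d → ℝ => ∑ i, w i * x i) 2 (Measure.pi η) := by
  refine memLp_finsetSum _ fun i _ => ?_
  have h := ((aux_memLp_id η hi i).const_mul (w i)).comp_measurePreserving
    (measurePreserving_eval η i)
  exact h

lemma aux_mean (hi : ∀ j, Integrable (fun t : ℝ => t ^ 2) (η j)) (m : Fin d → ℝ)
    (hm : ∀ i, (∫ t, t ∂(η i)) = m i) (w : Fin d → ℝ) :
    ∫ x, (∑ i, w i * x i) ∂(Measure.pi η) = ∑ i, w i * m i := by
  rw [integral_finsetSum]
  · refine Finset.sum_congr rfl fun i _ => ?_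
    rw [integral_const_mul, ← hm i]
    congr 1
    exact integral_comp_eval (μ := η) (i := i) (f := fun t : ℝ => t) (by fun_prop)
  · intro i _
    have h := ((aux_memLp_id η hi i).const_mul (w i)).comp_measurePreserving
      (measurePreserving_eval η i)
    exact MemLp.integrable (by norm_num) h

lemma aux_var (hi : ∀ j, Integrable (fun t : ℝ => t ^ 2) (η j)) (m σ : Fin d → ℝ)
    (hm : ∀ i, (∫ t, t ∂(η i)) = m i)
    (hv : ∀ i, (∫ t, (t - m i) ^ 2 ∂(η i)) = (σ i) ^ 2) (w : Fin d → ℝ) :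
    ∫ x, (∑ i, w i * x i - ∑ i, w i * m i) ^ 2 ∂(Measure.pi η) = ∑ i, w i ^ 2 * σ i ^ 2 := by
  have h := ProbabilityTheory.variance_sum_pi (μ := η) (X := fun i t => w i * t)
    (fun i => (aux_memLp_id η hi i).const_mul (w i))
  have e : (∑ i, fun ω : Fin d → ℝ => w i * ω i) = fun x => ∑ i, w i * x i := by
    ext x; simp
  rw [e, ProbabilityTheory.variance_eq_integral (aux_memLp η hi w).aemeasurable,
    aux_mean η hi m hm] at h
  rw [h]
  refine Finset.sum_congr rfl fun i _ => ?_
  rw [ProbabilityTheory.variance_const_mul, ProbabilityTheory.variance_eq_integral (by fun_prop),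
    hm, hv]

lemma aux_integrable (hi : ∀ j, Integrable (fun t : ℝ => t ^ 2) (η j)) (w : Fin d → ℝ) :
    Integrable (fun x : Fin d → ℝ => 1 - ∑ i, w i * x i) (Measure.pi η) :=
  (integrable_const _).sub ((aux_memLp η hi w).integrable (by norm_num))

lemma aux_hinge_integrable (hi : ∀ j, Integrable (fun t : ℝ => t ^ 2) (η j)) (w : Fin d → ℝ) :
    Integrable (fun x : Fin d → ℝ => max 0 (1 - ∑ i, w i * x i)) (Measure.pi η) := by
  have h := (aux_integrable η hi w).pos_part
  simpa only [max_comm] using h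

lemma aux_lower (hi : ∀ j, Integrable (fun t : ℝ => t ^ 2) (η j)) (m : Fin d → ℝ)
    (hm : ∀ i, (∫ t, t ∂(η i)) = m i) (w : Fin d → ℝ) :
    1 - ∑ i, w i * m i ≤ hingeAux η w := by
  have h := integral_mono (aux_integrable η hi w) (aux_hinge_integrable η hi w)
    (fun x => le_max_right _ _)
  rw [integral_sub (integrable_const _) ((aux_memLp η hi w).integrable (by norm_num)),
    aux_mean η hi m hm] at h
  simpa [hingeAux] using h

lemma aux_upper (hi : ∀ j, Integrable (fun t : ℝ => t ^ 2) (η j)) (m σ : Fin d → ℝ)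
    (hm : ∀ i, (∫ t, t ∂(η i)) = m i)
    (hv : ∀ i, (∫ t, (t - m i) ^ 2 ∂(η i)) = (σ i) ^ 2) (w : Fin d → ℝ)
    (hw : ∑ i, w i * m i = 1) :
    hingeAux η w ≤ Real.sqrt (∑ i, w i ^ 2 * σ i ^ 2) / 2 := by
  have hX := aux_integrable η hi w
  have hX2 : MemLp (fun x : Fin d → ℝ => 1 - ∑ i, w i * x i) 2 (Measure.pi η) :=
    (memLp_const _).sub (aux_memLp η hi w)
  have h0 : ∫ x, (1 - ∑ i, w i * x i) ∂(Measure.pi η) = 0 := by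
    rw [integral_sub (integrable_const _) ((aux_memLp η hi w).integrable (by norm_num)),
      aux_mean η hi m hm, hw]
    simp
  have hv2 := aux_var η hi m σ hm hv w
  rw [hw] at hv2
  have habs : ∫ x, |1 - ∑ i, w i * x i| ∂(Measure.pi η) ≤
      Real.sqrt (∑ i, w i ^ 2 * σ i ^ 2) := by
    apply Real.le_sqrt_of_sq_le
    have hn := ProbabilityTheory.variance_nonneg
      (fun x : Fin d → ℝ => |1 - ∑ i, w i * x i|) (Measure.pi η)
    have hA : MemLp (fun x : Fin d → ℝ => |1 - ∑ i, w i * x i|) 2 (Measure.pi η) := hX2.abs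
    rw [ProbabilityTheory.variance_eq_sub hA] at hn
    have e : ∫ x, ((fun x : Fin d → ℝ => |1 - ∑ i, w i * x i|) ^ 2) x ∂(Measure.pi η)
        = ∑ i, w i ^ 2 * σ i ^ 2 := by
      rw [← hv2]
      congr 1
      ext x
      simp only [Pi.pow_apply, sq_abs]
      ring
    rw [e] at hn
    linarith
  have e : hingeAux η w = ∫ x, ((1 - ∑ i, w i * x i) + |1 - ∑ i, w i * x i|) / 2
      ∂(Measure.pi η) := by
    unfold hingeAux
    congr 1
    ext x
    rcases le_total 0 (1 - ∑ i, w i * x i) with h | h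
    · rw [max_eq_right h, abs_of_nonneg h]; ring
    · rw [max_eq_left h, abs_of_nonpos h]; ring
  rw [e, integral_div, integral_add hX hX.abs, h0]
  linarith

lemma aux_convex (hi : ∀ j, Integrable (fun t : ℝ => t ^ 2) (η j)) (w v : Fin d → ℝ) (t : ℝ)
    (ht0 : 0 ≤ t) (ht1 : t ≤ 1) :
    hingeAux η (fun i => (1 - t) * w i + t * v i) ≤
      (1 - t) * hingeAux η w + t * hingeAux η v := by
  unfold hingeAux
  rw [← integral_const_mul, ← integral_const_mul, ← integral_add
    ((aux_hinge_integrable η hi w).const_mul _) ((aux_hinge_integrable η hi v).const_mul _)]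
  refine integral_mono (aux_hinge_integrable η hi _)
    (((aux_hinge_integrable η hi w).const_mul _).add
      ((aux_hinge_integrable η hi v).const_mul _)) fun x => ?_
  have e : ∑ i, ((1 - t) * w i + t * v i) * x i
      = (1 - t) * ∑ i, w i * x i + t * ∑ i, v i * x i := by
    rw [Finset.mul_sum, Finset.mul_sum, ← Finset.sum_add_distrib]
    exact Finset.sum_congr rfl fun i _ => by ring
  simp only [e]
  have h1 := mul_le_mul_of_nonneg_left (le_max_right 0 (1 - ∑ i, w i * x i)) (sub_nonneg.2 ht1)
  have h2 := mul_le_mul_of_nonneg_left (le_max_right 0 (1 - ∑ i, v i * x i)) ht0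
  have h3 := mul_nonneg (sub_nonneg.2 ht1) (le_max_left 0 (1 - ∑ i, w i * x i))
  have h4 := mul_nonneg ht0 (le_max_left 0 (1 - ∑ i, v i * x i))
  apply max_le <;> linarith

end aux

lemma aux_loss {d : ℕ} (ηp ηn : Fin d → Measure ℝ)
    [∀ i, IsProbabilityMeasure (ηp i)] [∀ i, IsProbabilityMeasure (ηn i)]
    (q : ℝ≥0∞) (hq : q ≤ 1) (lam : ℝ)
    (hip : ∀ j, Integrable (fun t : ℝ => t ^ 2) (ηp j))
    (hin : ∀ j, Integrable (fun t : ℝ => t ^ 2) (ηn j)) (w : Fin d → ℝ) :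
    svmLoss (jointMeasure ηp ηn q) lam w =
      q.toReal * hingeAux ηp w + (1 - q.toReal) * hingeAux ηn (fun i => - w i)
        + lam / 2 * ∑ i, (w i) ^ 2 := by
  have hqt : q ≠ ⊤ := ne_top_of_le_ne_top ENNReal.one_ne_top hq
  have hqt' : 1 - q ≠ ⊤ := ne_top_of_le_ne_top ENNReal.one_ne_top tsub_le_self
  have hc : Continuous (fun p : (Fin d → ℝ) × ℝ => max 0 (1 - p.2 * ∑ i, w i * p.1 i)) := by
    fun_prop
  have m1 : Measurable (fun x : Fin d → ℝ => (x, (1 : ℝ))) := by fun_prop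
  have m2 : Measurable (fun x : Fin d → ℝ => (x, (-1 : ℝ))) := by fun_prop
  have e2 : (fun x : Fin d → ℝ => max 0 (1 - (-1) * ∑ i, w i * x i)) =
      fun x => max 0 (1 - ∑ i, (fun i => - w i) i * x i) := by
    ext x; simp
  have i1 : Integrable (fun p : (Fin d → ℝ) × ℝ => max 0 (1 - p.2 * ∑ i, w i * p.1 i))
      ((Measure.pi ηp).map (fun x => (x, (1 : ℝ)))) := by
    rw [integrable_map_measure hc.aestronglyMeasurable m1.aemeasurable]
    simpa [Function.comp_def] using aux_hinge_integrable ηp hip w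
  have i2 : Integrable (fun p : (Fin d → ℝ) × ℝ => max 0 (1 - p.2 * ∑ i, w i * p.1 i))
      ((Measure.pi ηn).map (fun x => (x, (-1 : ℝ)))) := by
    rw [integrable_map_measure hc.aestronglyMeasurable m2.aemeasurable]
    have := aux_hinge_integrable ηn hin (fun i => - w i)
    rw [← e2] at this
    exact this
  unfold svmLoss jointMeasure
  rw [integral_add_measure (i1.smul_measure hqt) (i2.smul_measure hqt'),
    integral_smul_measure, integral_smul_measure,
    integral_map m1.aemeasurable hc.aestronglyMeasurable,
    integral_map m2.aemeasurable hc.aestronglyMeasurable,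
    ENNReal.toReal_sub_of_le hq ENNReal.one_ne_top]
  simp only [e2, hingeAux, smul_eq_mul, one_mul, ENNReal.toReal_one]

/-- with `E[xᵢ|y] = yμᵢ`, `Var(xᵢ|y) = σᵢ²` and features conditionally
independent given the label, any minimizer `w*` of the regularized soft-SVM objective satisfies
`‖w*‖₂ ≥ (1/‖μ‖₂)(1 - (1/2)(σ̄_μ/‖μ‖₂ + λ/(2‖μ‖₂²)))` where
`σ̄_μ² = (∑ μᵢ²σᵢ²)/(∑ μᵢ²)`. -/
theorem svm_minimizer_norm_lower_bound {d : ℕ} (ηp ηn : Fin d → Measure ℝ)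
    [∀ i, IsProbabilityMeasure (ηp i)] [∀ i, IsProbabilityMeasure (ηn i)]
    (q : ℝ≥0∞) (hq : q ≤ 1) (lam : ℝ) (hlam : 0 < lam)
    (μv σ : Fin d → ℝ)
    (hip : ∀ j, Integrable (fun t : ℝ => t ^ 2) (ηp j))
    (hin : ∀ j, Integrable (fun t : ℝ => t ^ 2) (ηn j))
    (hmeanp : ∀ i, (∫ t, t ∂(ηp i)) = μv i)
    (hmeann : ∀ i, (∫ t, t ∂(ηn i)) = -(μv i))
    (hvarp : ∀ i, (∫ t, (t - μv i) ^ 2 ∂(ηp i)) = (σ i) ^ 2)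
    (hvarn : ∀ i, (∫ t, (t + μv i) ^ 2 ∂(ηn i)) = (σ i) ^ 2)
    (hμ : 0 < ∑ i, (μv i) ^ 2)
    (wstar : Fin d → ℝ)
    (hmin : ∀ w, svmLoss (jointMeasure ηp ηn q) lam wstar ≤
      svmLoss (jointMeasure ηp ηn q) lam w) :
    (1 / Real.sqrt (∑ i, (μv i) ^ 2)) *
        (1 - (1 / 2) * (Real.sqrt ((∑ i, (μv i) ^ 2 * (σ i) ^ 2) / ∑ i, (μv i) ^ 2) /
            Real.sqrt (∑ i, (μv i) ^ 2) + lam / (2 * ∑ i, (μv i) ^ 2))) ≤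
      Real.sqrt (∑ i, (wstar i) ^ 2) := by
  have hq0 : 0 ≤ q.toReal := ENNReal.toReal_nonneg
  have hq1 : 0 ≤ 1 - q.toReal := by
    have := ENNReal.toReal_mono ENNReal.one_ne_top hq
    simp at this; linarith
  simp only [aux_loss ηp ηn q hq lam hip hin] at hmin
  set S := ∑ i, (μv i) ^ 2 with hS
  set T := ∑ i, (μv i) ^ 2 * (σ i) ^ 2 with hT
  set V := ∑ i, (wstar i) ^ 2 with hV
  set c := ∑ i, wstar i * μv i with hc
  have hvarn' : ∀ i, (∫ t, (t - -(μv i)) ^ 2 ∂(ηn i)) = (σ i) ^ 2 := by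
    intro i; rw [← hvarn i]; simp only [sub_neg_eq_add]
  -- the candidate
  set v : Fin d → ℝ := fun i => μv i / S with hv
  have hvm : ∑ i, v i * μv i = 1 := by
    have : ∑ i, v i * μv i = S / S := by
      rw [hS, Finset.sum_div]
      exact Finset.sum_congr rfl fun i _ => by simp only [hv, hS]; ring
    rw [this, div_self hμ.ne']
  have hvv : ∑ i, v i ^ 2 = 1 / S := by
    have : ∑ i, v i ^ 2 = S / S ^ 2 := by
      conv_rhs => rw [hS, Finset.sum_div]
      exact Finset.sum_congr rfl fun i _ => by simp only [hv, div_pow, ← hS]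
    rw [this]; field_simp
  have hvs : ∑ i, v i ^ 2 * σ i ^ 2 = T / S ^ 2 := by
    rw [hT, Finset.sum_div]
    exact Finset.sum_congr rfl fun i _ => by simp only [hv]; ring
  have hwv : ∑ i, wstar i * v i = c / S := by
    rw [hc, Finset.sum_div]
    exact Finset.sum_congr rfl fun i _ => by simp only [hv]; ring
  have hup := aux_upper ηp hip μv σ hmeanp hvarp v hvm
  have hun := aux_upper ηn hin (fun i => -(μv i)) σ hmeann hvarn' (fun i => - v i)
    (by simpa using hvm)
  have hlp := aux_lower ηp hip μv hmeanp wstar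
  have hln := aux_lower ηn hin (fun i => -(μv i)) hmeann (fun i => - wstar i)
  simp only [neg_sq, neg_mul_neg] at hun hln
  rw [hvs] at hup hun
  rw [← hc] at hlp hln
  set R := Real.sqrt (T / S ^ 2) with hR
  -- averaged bounds
  have hU : q.toReal * hingeAux ηp v + (1 - q.toReal) * hingeAux ηn (fun i => - v i) ≤ R / 2 := by
    nlinarith [mul_le_mul_of_nonneg_left hup hq0, mul_le_mul_of_nonneg_left hun hq1]
  have hL : 1 - c ≤ q.toReal * hingeAux ηp wstar
      + (1 - q.toReal) * hingeAux ηn (fun i => - wstar i) := by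
    nlinarith [mul_le_mul_of_nonneg_left hlp hq0, mul_le_mul_of_nonneg_left hln hq1]
  set D := V - 2 * (c / S) + 1 / S with hD
  -- strong convexity
  have hstep : ∀ t : ℝ, 0 < t → t ≤ 1 →
      1 - c + lam / 2 * V + lam / 2 * (1 - t) * D ≤ R / 2 + lam / 2 * (1 / S) := by
    intro t ht0 ht1
    have h := hmin (fun i => (1 - t) * wstar i + t * v i)
    have c1 := aux_convex ηp hip wstar v t ht0.le ht1
    have c2 := aux_convex ηn hin (fun i => - wstar i) (fun i => - v i) t ht0.le ht1
    have e2 : (fun i => -((1 - t) * wstar i + t * v i)) =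
        fun i => (1 - t) * (- wstar i) + t * (- v i) := by ext i; ring
    have e3 : ∑ i, ((1 - t) * wstar i + t * v i) ^ 2 =
        (1 - t) * V + t * (1 / S) - t * (1 - t) * D := by
      have : ∑ i, ((1 - t) * wstar i + t * v i) ^ 2 =
          (1 - t) ^ 2 * V + 2 * t * (1 - t) * ∑ i, wstar i * v i + t ^ 2 * ∑ i, v i ^ 2 := by
        rw [hV, Finset.mul_sum, Finset.mul_sum, Finset.mul_sum, ← Finset.sum_add_distrib,
          ← Finset.sum_add_distrib]
        exact Finset.sum_congr rfl fun i _ => by ring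
      rw [this, hwv, hvv, hD]; ring
    simp only [e2, e3] at h
    have c1' := mul_le_mul_of_nonneg_left c1 hq0
    have c2' := mul_le_mul_of_nonneg_left c2 hq1
    set A := q.toReal * hingeAux ηp wstar
      + (1 - q.toReal) * hingeAux ηn (fun i => - wstar i) with hA
    set B := q.toReal * hingeAux ηp v + (1 - q.toReal) * hingeAux ηn (fun i => - v i) with hB
    have key : t * (A + lam / 2 * V + lam / 2 * (1 - t) * D) ≤ t * (B + lam / 2 * (1 / S)) := by
      have : A + lam / 2 * V ≤ (1 - t) * A + t * B
          + lam / 2 * ((1 - t) * V + t * (1 / S) - t * (1 - t) * D) := by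
        rw [hA, hB]; linarith
      linarith
    have := le_of_mul_le_mul_left key ht0
    linarith
  have hmain : 1 - c + lam / 2 * V + lam / 2 * D ≤ R / 2 + lam / 2 * (1 / S) := by
    by_contra hcon
    push Not at hcon
    have hlim : Filter.Tendsto (fun t : ℝ => 1 - c + lam / 2 * V + lam / 2 * (1 - t) * D)
        (nhdsWithin 0 (Set.Ioi 0)) (nhds (1 - c + lam / 2 * V + lam / 2 * D)) := by
      have : Continuous (fun t : ℝ => 1 - c + lam / 2 * V + lam / 2 * (1 - t) * D) := by fun_prop
      have h := this.tendsto 0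
      simp only [sub_zero, mul_one] at h
      exact h.mono_left nhdsWithin_le_nhds
    have : 1 - c + lam / 2 * V + lam / 2 * D ≤ R / 2 + lam / 2 * (1 / S) := by
      refine le_of_tendsto hlim ?_
      filter_upwards [Ioc_mem_nhdsGT (zero_lt_one (α := ℝ))] with t ht
      exact hstep t ht.1 ht.2
    linarith
  -- final algebra
  set M := Real.sqrt S with hM
  have hM0 : 0 < M := Real.sqrt_pos.2 hμ
  have hMS : S = M ^ 2 := (Real.sq_sqrt hμ.le).symm
  set W := Real.sqrt V with hW
  have hV0 : 0 ≤ V := Finset.sum_nonneg fun i _ => sq_nonneg _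
  have hWV : V = W ^ 2 := (Real.sq_sqrt hV0).symm
  have hcs : c ≤ M * W := by
    have h := Finset.sum_mul_sq_le_sq_mul_sq Finset.univ wstar μv
    have h2 : c ^ 2 ≤ (M * W) ^ 2 := by
      rw [mul_pow, ← hMS, ← hWV, mul_comm]; exact h
    exact (abs_le_of_sq_le_sq' h2 (by positivity)).2
  have hRR : Real.sqrt (T / S) / M = R := by
    rw [hR, hM, ← Real.sqrt_div' _ hμ.le]
    congr 1; field_simp
  rw [hRR]
  set k := lam / S with hk
  have hk0 : 0 < k := div_pos hlam hμ
  have hlk : lam = k * M ^ 2 := by rw [hk, ← hMS]; field_simp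
  have h1 : 1 - R / 2 ≤ c * (1 + k) - k * (M * W) ^ 2 := by
    have e : lam / 2 * V + lam / 2 * D - lam / 2 * (1 / S) = k * (M * W) ^ 2 - k * c := by
      rw [hD, mul_pow, ← hMS, ← hWV, hk]; field_simp; ring
    linarith
  have h2 : 1 - R / 2 - k / 4 ≤ M * W := by
    nlinarith [mul_le_mul_of_nonneg_right hcs (by linarith : 0 ≤ 1 + k),
      mul_nonneg hk0.le (sq_nonneg (M * W - 1 / 2))]
  have e : lam / (2 * S) = k / 2 := by rw [hk]; field_simp
  rw [e, one_div, inv_mul_le_iff₀ hM0]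
  linarith
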